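/- Let W be an admissible Wilson loop diagram containing at least one propagator. Then for every starting vertex i ∈ [n] and every propagator p ∈ P, the vertex I_i^W(p) contributed by p to I_i^W is not the maximal element of V(p) with respect to the linear order <_i. -/

import Mathlib

open scoped Classical

namespace WLD

/-- A propagator of a Wilson loop diagram on the cyclically ordered vertex set
`ZMod n` (vertex `n` is identified with `0`): an unordered pair of edges, the
edge joining vertex `i` to vertex `i+1` being labelled `i`. -/
abbrev Prp (n : ℕ) := Sym2 (ZMod n)

variable (n : ℕ)

/-- The position of `x` in the linear order `i <_i i+1 <_i ⋯ <_i i-1`. -/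
def ord (i x : ZMod n) : ℕ := (x - i).val

/-- The other end of a propagator `p` having an end on the edge `e`. -/
noncomputable def otherEnd (p : Prp n) (e : ZMod n) : ZMod n :=
  if h : e ∈ p then Sym2.Mem.other h else e

/-- The vertex support `V(p) = {i, i+1, j, j+1}` of the propagator `p = (i,j)`. -/
def supp (p : Prp n) : Finset (ZMod n) :=
  Sym2.lift ⟨fun i j => {i, i + 1, j, j + 1}, fun i j => by
    ext x
    simp only [Finset.mem_insert, Finset.mem_singleton]
    tauto⟩ p

/-- The vertex support `V(Q)` of a set of propagators. -/
def suppSet (Q : Finset (Prp n)) : Finset (ZMod n) := Q.biUnion (supp n)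

/-- `Prop(U)`: the propagators of `P` supported on (a vertex of) `U`. -/
noncomputable def propsOn (P : Finset (Prp n)) (U : Finset (ZMod n)) : Finset (Prp n) :=
  P.filter fun p => (supp n p ∩ U).Nonempty

/-- Two propagators `p = (i,j)` and `q = (k,l)` cross if `i < k < j < l` cyclically. -/
def Crossing (p q : Prp n) : Prop :=
  ∃ i j k l : ZMod n, p = s(i, j) ∧ q = s(k, l) ∧
    0 < ord n i k ∧ ord n i k < ord n i j ∧ ord n i j < ord n i l

/-- Weak admissibility of a Wilson loop diagram. -/
structure IsWeaklyAdmissible (P : Finset (Prp n)) : Prop where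
  dense : ∀ Q ⊆ P, Q.Nonempty → Q.card + 3 ≤ (suppSet n Q).card
  noncross : ∀ p ∈ P, ∀ q ∈ P, ¬ Crossing n p q

/-- Admissibility of a Wilson loop diagram. -/
structure IsAdmissible (P : Finset (Prp n)) : Prop where
  card_add_four_le : P.card + 4 ≤ n
  dense : ∀ Q ⊆ P, Q.Nonempty → Q.card + 3 ≤ (suppSet n Q).card
  noncross : ∀ p ∈ P, ∀ q ∈ P, ¬ Crossing n p q

/-- The length of a propagator `p = (i,j)`:
`min(|[i+1, j]|, |[j+1, i]|)`, the number of vertices on its smaller side. -/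
def plength (p : Prp n) : ℕ :=
  Sym2.lift ⟨fun i j => min ((j - i - 1).val + 1) ((i - j - 1).val + 1),
    fun _ _ => min_comm _ _⟩ p

/-- `InsideDir n i p q` : the propagator `q = (k,l)` lies (weakly) inside the
propagator `p = (i,j)` directed from its end `i`, i.e. `i ≤_i k <_i l ≤_i j`. -/
def InsideDir (i : ZMod n) (p q : Prp n) : Prop :=
  ∃ j k l : ZMod n, p = s(i, j) ∧ q = s(k, l) ∧
    ord n i k < ord n i l ∧ ord n i l ≤ ord n i j

/-- Sorting key measuring how far clockwise of the vertex `a` the relevant end of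
a propagator supported on `a` is attached: ends on the edge `a-1` are clockwise of
ends on the edge `a`, and on a fixed edge an end is the more clockwise the larger
the propagator is (nestedness of noncrossing propagators sharing an edge). -/
noncomputable def cwKey (a : ZMod n) (p : Prp n) : ℕ :=
  if a - 1 ∈ p then n + ord n (a - 1) (otherEnd n p (a - 1))
  else ord n a (otherEnd n p a)

/-- The clockwise-most propagator of `S` supported on the vertex `a`, if any. -/
noncomputable def pickCW (S : Finset (Prp n)) (a : ZMod n) : Option (Prp n) :=
  if h : (S.filter fun p => a ∈ supp n p).Nonempty then
    some (Classical.choose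
      ((S.filter fun p => a ∈ supp n p).exists_max_image (cwKey n a) h))
  else none

/-- The Grassmann necklace algorithm started at the vertex `i`: after `t` steps,
`(gnRun n P i t).1` is the set of propagators not yet deleted, and
`(gnRun n P i t).2` records the vertex assigned to each deleted propagator.
Step `t+1` processes the vertex `i + t`: if some not-yet-deleted propagator is
supported on it, the clockwise-most such propagator is deleted and assigned
that vertex. -/
noncomputable def gnRun (P : Finset (Prp n)) (i : ZMod n) :
    ℕ → Finset (Prp n) × (Prp n → Option (ZMod n))
  | 0 => (P, fun _ => none)
  | t + 1 =>
    match pickCW n (gnRun P i t).1 (i + (t : ZMod n)) with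
    | none => gnRun P i t
    | some p => ((gnRun P i t).1.erase p,
        Function.update (gnRun P i t).2 p (some (i + (t : ZMod n))))

/-- `I_i^W(p)`: the vertex contributed by the propagator `p` to the Grassmann
necklace term `I_i^W` (as an `Option`; the algorithm makes one full circuit of
the vertex set, i.e. runs for `n` steps). -/
noncomputable def gnAssign (P : Finset (Prp n)) (i : ZMod n) (p : Prp n) :
    Option (ZMod n) :=
  (gnRun n P i n).2 p

/-- The Grassmann necklace term `I_i^W` produced by the algorithm. -/
noncomputable def gnSet [NeZero n] (P : Finset (Prp n)) (i : ZMod n) :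
    Finset (ZMod n) :=
  Finset.univ.filter fun v => ∃ p, gnAssign n P i p = some v

/-- The cyclic interval `{a, a+1, …, a + (len-1)}` in `ZMod n`. -/
def cInterval [NeZero n] (a : ZMod n) (len : ℕ) : Finset (ZMod n) :=
  Finset.univ.filter fun x => ord n a x < len

/-- A Grassmann necklace of type `(k, n)`: a cyclic sequence of `k`-element
subsets of the vertex set such that `I_{i+1} = (I_i \ {i}) ∪ {j}` for some `j`
whenever `i ∈ I_i`, and `I_{i+1} = I_i` otherwise. -/
def IsGrassmannNecklace [NeZero n] (k : ℕ) (I : ZMod n → Finset (ZMod n)) : Prop :=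
  (∀ i, (I i).card = k) ∧
  ∀ i : ZMod n,
    (i ∈ I i → ∃ j : ZMod n, I (i + 1) = insert j ((I i).erase i)) ∧
    (i ∉ I i → I (i + 1) = I i)

/-- Independence in the matroid `M(W)`: no subset `U` of `J` supports fewer
propagators than the vertices it contains. -/
def Indep (P : Finset (Prp n)) (J : Finset (ZMod n)) : Prop :=
  ∀ U ⊆ J, U.card ≤ (propsOn n P U).card

/-- `A` is lexicographically smaller than `B` with respect to the order `<_i`:
the `<_i`-least element of the symmetric difference lies in `A`. -/
def LexLt (i : ZMod n) (A B : Finset (ZMod n)) : Prop :=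
  ∃ v, v ∈ A ∧ v ∉ B ∧ ∀ w, ord n i w < ord n i v → (w ∈ A ↔ w ∈ B)

/-- A `+` is placed in the box `(a, b)` of the Le diagram with row labels `I₁`
by the necklace term `Ii`: writing `I₁ \ Ii = {a₁ > ⋯ > a_r}` and
`Ii \ I₁ = {b₁ < ⋯ < b_r}` in the `<₁` order, the plusses are in the boxes
`(a_t, b_t)`. -/
def LePlusAt (I₁ Ii : Finset (ZMod n)) (a b : ZMod n) : Prop :=
  a ∈ I₁ \ Ii ∧ b ∈ Ii \ I₁ ∧
    ((I₁ \ Ii).filter fun x => ord n 1 a < ord n 1 x).card =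
      ((Ii \ I₁).filter fun y => ord n 1 y < ord n 1 b).card

/-- The box `(a, b)` of the Le diagram of the diagram `P` contains a `+`. -/
def LePlus [NeZero n] (P : Finset (Prp n)) (a b : ZMod n) : Prop :=
  ∃ i : ZMod n, LePlusAt n (gnSet n P 1) (gnSet n P i) a b

/-- The number of `+` entries in the Le diagram of the diagram `P`. -/
noncomputable def plusCount [NeZero n] (P : Finset (Prp n)) : ℕ :=
  (Finset.univ.filter fun ab : ZMod n × ZMod n => LePlus n P ab.1 ab.2).card

/-- The length of the row labelled `a` of the Young diagram with row labels `I₁`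
(the boxes of row `a` are indexed by the column labels `b ∉ I₁` with `a <₁ b`). -/
noncomputable def rowLen [NeZero n] (I₁ : Finset (ZMod n)) (a : ZMod n) : ℕ :=
  (Finset.univ.filter fun b => b ∉ I₁ ∧ ord n 1 a < ord n 1 b).card

/-- The entry of the matrix `C(W)` in row `p` and column `q`: the indeterminate
`x_{p,q}` if `q ∈ V(p)`, and `0` otherwise. -/
noncomputable def CW (p : Prp n) (q : ZMod n) : MvPolynomial (Prp n × ZMod n) ℝ :=
  if q ∈ supp n p then MvPolynomial.X (p, q) else 0

/-- The column paired with the row `p` in the minors determined by `I_i^W`. -/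
noncomputable def colOf (P : Finset (Prp n)) (i : ZMod n) (p : Prp n) : ZMod n :=
  (gnAssign n P i p).getD i

/-- `Δ_{I_i}`: the determinant of the `k × k` minor of `C(W)` on the columns
indexed by `I_i^W`, rows and columns paired via the necklace assignment. -/
noncomputable def Delta (P : Finset (Prp n)) (i : ZMod n) :
    MvPolynomial (Prp n × ZMod n) ℝ :=
  Matrix.det (Matrix.of fun p q : ↥P => CW n (p : Prp n) (colOf n P i (q : Prp n)))

/-- `S_i`: the propagators whose contribution changes from `I_{i-1}` to `I_i`. -/
noncomputable def Schanged (P : Finset (Prp n)) (i : ZMod n) : Finset (Prp n) :=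
  P.filter fun p => gnAssign n P (i - 1) p ≠ gnAssign n P i p

/-- `r_i`: the determinant of the minor of `C(W)` with rows indexed by `S_i` and
columns indexed by `I_i(S_i)` (equal to `1` when `S_i = ∅`). -/
noncomputable def rfac (P : Finset (Prp n)) (i : ZMod n) :
    MvPolynomial (Prp n × ZMod n) ℝ :=
  Matrix.det
    (Matrix.of fun p q : ↥(Schanged n P i) => CW n (p : Prp n) (colOf n P i (q : Prp n)))

/-- `R = ∏ᵢ rᵢ`, the polynomial produced by the algorithm. -/
noncomputable def Rpoly [NeZero n] (P : Finset (Prp n)) :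
    MvPolynomial (Prp n × ZMod n) ℝ :=
  ∏ i : ZMod n, rfac n P i

/-- Position of the end of the propagator `p` along the edge `e`: larger values
attach closer to the vertex `e`, i.e. earlier in the counterclockwise ordering
of the ends of propagators along the edge `e`. -/
noncomputable def edgeKey (e : ZMod n) (p : Prp n) : ℕ := ord n e (otherEnd n p e)

/-- The propagators of `P` with an end on the edge `e`. -/
noncomputable def onEdge (P : Finset (Prp n)) (e : ZMod n) : Finset (Prp n) :=
  P.filter fun p => e ∈ p

/-- `p` is the first propagator (`p₁`) on the edge `e` in the counterclockwise
ordering of the propagators with an end on the edge `e`. -/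
def IsCcwFirst (P : Finset (Prp n)) (e : ZMod n) (p : Prp n) : Prop :=
  p ∈ onEdge n P e ∧ ∀ q ∈ onEdge n P e, edgeKey n e q ≤ edgeKey n e p

/-- `p` is the last propagator (`p_r`) on the edge `e` in the counterclockwise
ordering of the propagators with an end on the edge `e`. -/
def IsCcwLast (P : Finset (Prp n)) (e : ZMod n) (p : Prp n) : Prop :=
  p ∈ onEdge n P e ∧ ∀ q ∈ onEdge n P e, edgeKey n e p ≤ edgeKey n e q

/-- `p` and `q` are consecutive, in this order (`p = p_j`, `q = p_{j+1}`), in the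
counterclockwise ordering of the propagators with an end on the edge `e`. -/
def ConsecOnEdge (P : Finset (Prp n)) (e : ZMod n) (p q : Prp n) : Prop :=
  p ∈ onEdge n P e ∧ q ∈ onEdge n P e ∧ edgeKey n e q < edgeKey n e p ∧
    ∀ r ∈ onEdge n P e, ¬ (edgeKey n e q < edgeKey n e r ∧ edgeKey n e r < edgeKey n e p)

/-- The factor `R_e` of the denominator `R(W)` associated to the edge `e`:
`R_e = x_{p₁,e+1} • ∏_{j=1}^{r-1} (x_{p_j,e} x_{p_{j+1},e+1} - x_{p_{j+1},e} x_{p_j,e+1}) • x_{p_r,e}`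
for the counterclockwise ordering `p₁, …, p_r` of the propagators on the edge `e`
(`R_e = 1` if there are none). -/
noncomputable def Redge (P : Finset (Prp n)) (e : ZMod n) :
    MvPolynomial (Prp n × ZMod n) ℝ :=
  (∏ p ∈ (onEdge n P e).filter (IsCcwFirst n P e), MvPolynomial.X (p, e + 1)) *
    (∏ pq ∈ (P ×ˢ P).filter (fun pq => ConsecOnEdge n P e pq.1 pq.2),
      (MvPolynomial.X (pq.1, e) * MvPolynomial.X (pq.2, e + 1) -
        MvPolynomial.X (pq.2, e) * MvPolynomial.X (pq.1, e + 1))) *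
    (∏ p ∈ (onEdge n P e).filter (IsCcwLast n P e), MvPolynomial.X (p, e))

/-- The denominator `R(W) = ∏ₑ R_e` of the integrand `Ω(W)`. -/
noncomputable def RW [NeZero n] (P : Finset (Prp n)) :
    MvPolynomial (Prp n × ZMod n) ℝ :=
  ∏ e : ZMod n, Redge n P e

/-- The relabelling map associated to the removal of the vertex `i` from the
vertex set `ZMod n`: the vertex of `ZMod (n-1)` in position `t` (in the `<₁`
order) is sent to the vertex of `ZMod n` in position `t` if `t` precedes the
position of `i`, and to the vertex in position `t+1` otherwise. -/
noncomputable def liftVert (i : ZMod n) (x : ZMod (n - 1)) : ZMod n :=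
  1 + ((if ord (n - 1) 1 x < ord n 1 i then ord (n - 1) 1 x
        else ord (n - 1) 1 x + 1 : ℕ) : ZMod n)

end WLD
namespace WLD

section Basic

variable {n : ℕ}

lemma otherEnd_mk (x y : ZMod n) : otherEnd n s(x, y) x = y := by
  have h : x ∈ s(x, y) := Sym2.mem_mk_left x y
  rw [otherEnd, dif_pos h]
  exact Sym2.congr_right.mp (Sym2.other_spec h)

lemma mem_supp_iff (p : Prp n) (v : ZMod n) : v ∈ supp n p ↔ v - 1 ∈ p ∨ v ∈ p := by
  induction p using Sym2.ind with
  | _ x y =>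
    simp only [supp, Sym2.lift_mk, Finset.mem_insert, Finset.mem_singleton, Sym2.mem_iff,
      sub_eq_iff_eq_add]
    tauto

lemma self_mem_supp (x y : ZMod n) : x ∈ supp n s(x, y) := by
  simp [mem_supp_iff]

lemma succ_mem_supp (x y : ZMod n) : x + 1 ∈ supp n s(x, y) := by
  simp [mem_supp_iff]

lemma ord_add_natCast (i : ZMod n) {a : ℕ} (ha : a < n) : ord n i (i + (a : ZMod n)) = a := by
  simp [ord, ZMod.val_cast_of_lt ha]

lemma eq_mk_of_cwKey_le {v x : ZMod n} {r : Prp n} (hq : v - 1 ∉ s(v, x)) (hr : v ∈ supp n r)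
    (h : cwKey n v s(v, x) ≤ cwKey n v r) :
    (∃ y, r = s(v - 1, y)) ∨ ∃ y, r = s(v, y) ∧ ord n v x ≤ ord n v y := by
  by_cases hv : v - 1 ∈ r
  · exact .inl hv
  · obtain ⟨y, rfl⟩ := ((mem_supp_iff r v).mp hr).resolve_left hv
    rw [cwKey, cwKey, if_neg hq, if_neg hv, otherEnd_mk, otherEnd_mk] at h
    exact .inr ⟨y, rfl, h⟩

lemma ord_add_add_of_le (i : ZMod n) {a d : ℕ} (had : a ≤ d) (hd : d < n) :
    ord n (i + (a : ZMod n)) (i + (d : ZMod n)) = d - a := by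
  have h : i + (d : ZMod n) = i + (a : ZMod n) + ((d - a : ℕ) : ZMod n) := by
    rw [Nat.cast_sub had]; ring
  rw [h, ord_add_natCast _ (by omega)]

lemma ord_add_add_of_lt (i : ZMod n) {a d : ℕ} (hda : d < a) (ha : a < n) :
    ord n (i + (a : ZMod n)) (i + (d : ZMod n)) = n + d - a := by
  have h : i + (d : ZMod n) = i + (a : ZMod n) + ((n + d - a : ℕ) : ZMod n) := by
    rw [Nat.cast_sub (by omega)]; push_cast; rw [ZMod.natCast_self]; ring
  rw [h, ord_add_natCast _ (by omega)]

lemma add_natCast_inj (i : ZMod n) {a b : ℕ} (ha : a < n) (hb : b < n)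
    (h : i + (a : ZMod n) = i + (b : ZMod n)) : a = b := by
  rw [← ord_add_natCast i ha, h, ord_add_natCast i hb]

lemma crossing_of_lt (i : ZMod n) {a c b d : ℕ} (hac : a < c) (hcb : c < b) (hbd : b < d)
    (hd : d < n) :
    Crossing n s(i + (a : ZMod n), i + (b : ZMod n)) s(i + (c : ZMod n), i + (d : ZMod n)) := by
  refine ⟨_, _, _, _, rfl, rfl, ?_⟩
  rw [ord_add_add_of_le i hac.le (by omega), ord_add_add_of_le i (by omega) (by omega),
    ord_add_add_of_le i (by omega) hd]
  omega

variable [NeZero n]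

lemma ord_lt (x y : ZMod n) : ord n x y < n := ZMod.val_lt _

lemma exists_eq_add_natCast (i x : ZMod n) : ∃ a : ℕ, a < n ∧ x = i + (a : ZMod n) :=
  ⟨ord n i x, ord_lt i x, by simp [ord]⟩

/-- A propagator whose key at the vertex `v + 1` is at least that of one attached to the edge `v`
is itself attached to the edge `v`. -/
lemma eq_mk_of_cwKey_succ_le {v x : ZMod n} {r : Prp n}
    (h : cwKey n (v + 1) s(v, x) ≤ cwKey n (v + 1) r) :
    ∃ y, r = s(v, y) ∧ ord n v x ≤ ord n v y := by
  simp only [cwKey, add_sub_cancel_right, Sym2.mem_mk_left, if_true, otherEnd_mk] at h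
  by_cases hv : v ∈ r
  · obtain ⟨y, rfl⟩ := hv
    rw [if_pos (Sym2.mem_mk_left v y), otherEnd_mk] at h
    exact ⟨y, rfl, by omega⟩
  · rw [if_neg hv] at h
    have := ord_lt (v + 1) (otherEnd n r (v + 1))
    omega

end Basic

section Run

variable {n : ℕ}

lemma pickCW_eq_some {S : Finset (Prp n)} {v : ZMod n} {p : Prp n} (h : pickCW n S v = some p) :
    p ∈ S ∧ v ∈ supp n p ∧ ∀ q ∈ S, v ∈ supp n q → cwKey n v q ≤ cwKey n v p := by
  unfold pickCW at h
  split_ifs at h with hne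
  have hspec := Classical.choose_spec
    ((S.filter fun p => v ∈ supp n p).exists_max_image (cwKey n v) hne)
  rw [Option.some.inj h, Finset.mem_filter] at hspec
  exact ⟨hspec.1.1, hspec.1.2, fun q hq hv => hspec.2 q (Finset.mem_filter.mpr ⟨hq, hv⟩)⟩

lemma exists_pickCW_eq_some {S : Finset (Prp n)} {v : ZMod n} {p : Prp n} (hp : p ∈ S)
    (hv : v ∈ supp n p) : ∃ r, pickCW n S v = some r := by
  have hne : (S.filter fun p => v ∈ supp n p).Nonempty := ⟨p, Finset.mem_filter.mpr ⟨hp, hv⟩⟩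
  exact ⟨_, dif_pos hne⟩

variable (P : Finset (Prp n)) (i : ZMod n)

/-- The propagator `p` is deleted at the vertex `i + t` when the algorithm starts at `i`. -/
def PickedAt (t : ℕ) (p : Prp n) : Prop :=
  pickCW n (gnRun n P i t).1 (i + (t : ZMod n)) = some p

variable {P i}

lemma gnRun_succ_of_pickedAt {t : ℕ} {p : Prp n} (h : PickedAt P i t p) :
    gnRun n P i (t + 1) = ((gnRun n P i t).1.erase p,
      Function.update (gnRun n P i t).2 p (some (i + (t : ZMod n)))) := by
  rw [PickedAt] at h
  rw [gnRun, h]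

lemma gnRun_succ_of_none {t : ℕ} (h : pickCW n (gnRun n P i t).1 (i + (t : ZMod n)) = none) :
    gnRun n P i (t + 1) = gnRun n P i t := by
  rw [gnRun, h]

lemma gnRun_succ_subset (t : ℕ) : (gnRun n P i (t + 1)).1 ⊆ (gnRun n P i t).1 := by
  cases h : pickCW n (gnRun n P i t).1 (i + (t : ZMod n)) with
  | none => rw [gnRun_succ_of_none h]
  | some p =>
    rw [gnRun_succ_of_pickedAt h]
    exact Finset.erase_subset _ _

lemma gnRun_antitone : Antitone fun t => (gnRun n P i t).1 :=
  antitone_nat_of_succ_le gnRun_succ_subset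

lemma exists_pickedAt_of_gnRun {t : ℕ} {p : Prp n} {v : ZMod n}
    (h : (gnRun n P i t).2 p = some v) :
    ∃ s < t, v = i + (s : ZMod n) ∧ PickedAt P i s p := by
  induction t with
  | zero => simp [gnRun] at h
  | succ t ih =>
    cases hpick : pickCW n (gnRun n P i t).1 (i + (t : ZMod n)) with
    | none =>
      rw [gnRun_succ_of_none hpick] at h
      obtain ⟨s, hs, hsp⟩ := ih h
      exact ⟨s, by omega, hsp⟩
    | some q =>
      rw [gnRun_succ_of_pickedAt hpick] at h
      by_cases hpq : p = q
      · subst hpq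
        simp only [Function.update_self, Option.some.injEq] at h
        exact ⟨t, by omega, h.symm, hpick⟩
      · simp only [Function.update_of_ne hpq] at h
        obtain ⟨s, hs, hsp⟩ := ih h
        exact ⟨s, by omega, hsp⟩

lemma PickedAt.mem {t : ℕ} {p : Prp n} (h : PickedAt P i t p) : p ∈ P :=
  gnRun_antitone (Nat.zero_le t) (pickCW_eq_some h).1

lemma PickedAt.mem_supp {t : ℕ} {p : Prp n} (h : PickedAt P i t p) :
    i + (t : ZMod n) ∈ supp n p := (pickCW_eq_some h).2.1

/-- When a propagator is passed over at one of its support vertices, a more clockwise one is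
deleted there instead. -/
lemma PickedAt.exists_earlier {t : ℕ} {p : Prp n} (h : PickedAt P i t p) {s : ℕ} (hst : s < t)
    (hs : i + (s : ZMod n) ∈ supp n p) :
    ∃ r, PickedAt P i s r ∧ r ≠ p ∧
      cwKey n (i + (s : ZMod n)) p ≤ cwKey n (i + (s : ZMod n)) r := by
  have hp : p ∈ (gnRun n P i (s + 1)).1 :=
    gnRun_antitone (Nat.succ_le_of_lt hst) (pickCW_eq_some h).1
  have hp' := gnRun_succ_subset s hp
  obtain ⟨r, hr⟩ := exists_pickCW_eq_some hp' hs
  refine ⟨r, hr, ?_, (pickCW_eq_some hr).2.2 p hp' hs⟩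
  rintro rfl
  rw [gnRun_succ_of_pickedAt hr] at hp
  exact Finset.notMem_erase _ _ hp

end Run

section Admissible

variable {n : ℕ} {P : Finset (Prp n)} {i : ZMod n}

lemma IsAdmissible.card_supp (hadm : IsAdmissible n P) {p : Prp n} (hp : p ∈ P) :
    4 ≤ (supp n p).card := by
  have := hadm.dense {p} (by simpa using hp) (Finset.singleton_nonempty p)
  simpa [suppSet] using this

lemma card_supp_succ_le (x : ZMod n) : (supp n s(x, x + 1)).card ≤ 3 := by
  have : supp n s(x, x + 1) = {x, x + 1, x + 1 + 1} := by
    ext; simp [supp]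
  rw [this]
  exact Finset.card_le_three

lemma card_supp_self_le (x : ZMod n) : (supp n s(x, x)).card ≤ 3 := by
  have : supp n s(x, x) = {x, x + 1} := by
    ext; simp [supp]
  rw [this]
  exact Finset.card_le_two.trans (by omega)

lemma IsAdmissible.ends_of_mem (hadm : IsAdmissible n P) {a b : ℕ} (ha : a < n) (hb : b < n)
    (hp : s(i + (a : ZMod n), i + (b : ZMod n)) ∈ P) : a + 2 ≤ b ∨ b + 2 ≤ a := by
  have hcard := hadm.card_supp hp
  by_contra! hcon
  obtain rfl | rfl | rfl : b = a ∨ b = a + 1 ∨ a = b + 1 := by omega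
  · have := card_supp_self_le (i + (b : ZMod n))
    omega
  · have := card_supp_succ_le (i + (a : ZMod n))
    push_cast [← add_assoc] at hcard
    omega
  · have := card_supp_succ_le (i + (b : ZMod n))
    rw [Sym2.eq_swap] at hcard
    push_cast [← add_assoc] at hcard
    omega

variable [NeZero n]

/-- If the propagator passed over at the vertex `a + 1` has its lower end on the edge `a`, the one
deleted there has its lower end on `a` and is larger, or has its upper end on `a`. -/
lemma exists_picked_succ (hadm : IsAdmissible n P) {a b t : ℕ} (hab : a + 2 ≤ b) (hb : b < n)
    (hpick : PickedAt P i t s(i + (a : ZMod n), i + (b : ZMod n))) (hat : a + 1 < t) :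
    ∃ d < n, (b < d ∨ d + 2 ≤ a) ∧
      PickedAt P i (a + 1) s(i + (a : ZMod n), i + (d : ZMod n)) := by
  have hcast : i + ((a + 1 : ℕ) : ZMod n) = i + (a : ZMod n) + 1 := by push_cast; ring
  obtain ⟨r, hr, hne, hkey⟩ := hpick.exists_earlier hat (by rw [hcast]; exact succ_mem_supp _ _)
  rw [hcast] at hkey
  obtain ⟨y, rfl, hle⟩ := eq_mk_of_cwKey_succ_le hkey
  obtain ⟨d, hd, rfl⟩ := exists_eq_add_natCast i y
  refine ⟨d, hd, ?_, hr⟩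
  rcases hadm.ends_of_mem (by omega) hd hr.mem with h | h
  · rw [ord_add_add_of_le i (by omega) hb, ord_add_add_of_le i (by omega) hd] at hle
    have : d ≠ b := by rintro rfl; exact hne rfl
    omega
  · exact .inr h

/-- A propagator is not deleted at the far vertex `b + 1` of its upper edge `b`. -/
lemma not_pickedAt_succ_upper (hadm : IsAdmissible n P) (a b : ℕ) (hab : a + 2 ≤ b)
    (hb : b + 1 < n) : ¬ PickedAt P i (b + 1) s(i + (a : ZMod n), i + (b : ZMod n)) := by
  induction b using Nat.strong_induction_on generalizing a with
  | _ b ih =>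
    intro hpick
    obtain ⟨e, rfl⟩ : ∃ e, b = e + 1 := ⟨b - 1, by omega⟩
    have hsub : i + ((e + 1 : ℕ) : ZMod n) - 1 = i + (e : ZMod n) := by push_cast; ring
    rw [Sym2.eq_swap] at hpick
    obtain ⟨q, hq, hne, hkey⟩ := hpick.exists_earlier (Nat.lt_succ_self (e + 1))
      (self_mem_supp _ _)
    have hnot : i + ((e + 1 : ℕ) : ZMod n) - 1 ∉
        s(i + ((e + 1 : ℕ) : ZMod n), i + (a : ZMod n)) := by
      rw [hsub, Sym2.mem_iff]
      rintro (h | h)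
      · have := add_natCast_inj i (by omega) (by omega) h; omega
      · have := add_natCast_inj i (by omega) (by omega) h; omega
    rcases eq_mk_of_cwKey_le hnot hq.mem_supp hkey with ⟨y, rfl⟩ | ⟨y, rfl, hle⟩
    · rw [hsub] at hq
      obtain ⟨d, hd, rfl⟩ := exists_eq_add_natCast i y
      rcases hadm.ends_of_mem (by omega) hd hq.mem with h | h
      · rw [Sym2.eq_swap] at hpick
        exact hadm.noncross _ hpick.mem _ hq.mem
          (crossing_of_lt i (by omega) (by omega) (by omega) hd)
      · rw [Sym2.eq_swap] at hq
        exact ih e (by omega) d h (by omega) hq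
    · obtain ⟨c, hc, rfl⟩ := exists_eq_add_natCast i y
      have hca : c ≠ a := by rintro rfl; exact hne rfl
      rw [ord_add_add_of_lt i (by omega) (by omega)] at hle
      have hce : c + 2 ≤ e + 1 ∧ a < c := by
        rcases hadm.ends_of_mem (by omega) hc hq.mem with h | h
        · rw [ord_add_add_of_le i (by omega) hc] at hle
          omega
        · rw [ord_add_add_of_lt i (by omega) (by omega)] at hle
          omega
      rw [Sym2.eq_swap] at hq hpick
      obtain ⟨d, hd, hdb | hdc, hr⟩ := exists_picked_succ hadm hce.1 (by omega) hq (by omega)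
      · exact hadm.noncross _ hpick.mem _ hr.mem
          (crossing_of_lt i hce.2 (by omega) hdb hd)
      · rw [Sym2.eq_swap] at hr
        exact ih c (by omega) d hdc (by omega) hr

/-- A propagator ending on the edge just before the starting vertex is deleted before its near
vertex on that edge is reached. -/
lemma not_pickedAt_upper_of_last (hadm : IsAdmissible n P) {a b : ℕ} (hab : a + 2 ≤ b)
    (hb : b + 1 = n) : ¬ PickedAt P i b s(i + (a : ZMod n), i + (b : ZMod n)) := by
  intro hpick
  obtain ⟨d, hd, hdb | hda, hr⟩ := exists_picked_succ hadm hab (by omega) hpick (by omega)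
  · omega
  · rw [Sym2.eq_swap] at hr
    exact not_pickedAt_succ_upper hadm d a hda (by omega) hr

lemma exists_ord_lt_of_pickedAt (hadm : IsAdmissible n P) {a b t : ℕ} (hab : a + 2 ≤ b)
    (hb : b < n) (ht : t < n)
    (hpick : PickedAt P i t s(i + (a : ZMod n), i + (b : ZMod n))) :
    ∃ w ∈ supp n s(i + (a : ZMod n), i + (b : ZMod n)), t < ord n i w := by
  by_contra! hmax
  have htb : b ≤ t := by
    have := hmax (i + (b : ZMod n)) (by rw [Sym2.eq_swap]; exact self_mem_supp _ _)
    rwa [ord_add_natCast i hb] at this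
  have hcast : i + ((b + 1 : ℕ) : ZMod n) = i + (b : ZMod n) + 1 := by push_cast; ring
  by_cases hlast : b + 1 = n
  · obtain rfl : t = b := by omega
    exact not_pickedAt_upper_of_last hadm hab hlast hpick
  · have htb' : b + 1 ≤ t := by
      have := hmax (i + ((b + 1 : ℕ) : ZMod n))
        (by rw [Sym2.eq_swap, hcast]; exact succ_mem_supp _ _)
      rwa [ord_add_natCast i (by omega)] at this
    have hsupp := hpick.mem_supp
    obtain rfl : t = b + 1 := by
      rw [mem_supp_iff, Sym2.mem_iff, Sym2.mem_iff, sub_eq_iff_eq_add, sub_eq_iff_eq_add,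
        ← hcast, add_assoc, ← Nat.cast_succ] at hsupp
      rcases hsupp with (h | h) | (h | h) <;>
        have := add_natCast_inj i (by omega) (by omega) h <;> omega
    exact not_pickedAt_succ_upper hadm a b hab (by omega) hpick

end Admissible

/-- no propagator contributes its `<ᵢ`-last support vertex.
Let `W` be an admissible Wilson loop diagram containing at least one propagator.
For every starting vertex `i ∈ [n]` and every propagator `p ∈ P`, the vertex
`I_i^W(p)` contributed by `p` to `I_i^W` is not the maximal element of `V(p)`
with respect to the linear order `<_i`. -/
theorem gnAssign_not_max_of_supp
    (n : ℕ) [NeZero n] (P : Finset (Prp n)) (hadm : IsAdmissible n P)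
    (hne : P.Nonempty) :
    ∀ i : ZMod n, ∀ p ∈ P, ∀ v : ZMod n, gnAssign n P i p = some v →
      ∃ w ∈ supp n p, ord n i v < ord n i w := by
  intro i p hp v hv
  obtain ⟨t, ht, rfl, hpick⟩ := exists_pickedAt_of_gnRun hv
  rw [ord_add_natCast i ht]
  induction p using Sym2.ind with
  | _ x y =>
    obtain ⟨a, ha, rfl⟩ := exists_eq_add_natCast i x
    obtain ⟨b, hb, rfl⟩ := exists_eq_add_natCast i y
    rcases hadm.ends_of_mem ha hb hp with hab | hab
    · exact exists_ord_lt_of_pickedAt hadm hab hb ht hpick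
    · rw [Sym2.eq_swap] at hpick ⊢
      exact exists_ord_lt_of_pickedAt hadm hab ha ht hpick

end WLD
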